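/- Let T > 0 and α, β, λ > 0, and define the Gamma kernel k(t,s) := (α/Γ(β)) e^{−λ(t−s)} (t−s)^{β−1} for 0 ≤ s < t ≤ T. Then: (a) for all 0 ≤ s < t ≤ τ ≤ T and every n ≥ 2, κ̇^{n,τ}_{s,t} = α^n e^{−λ(τ−s)} ((τ−s)^{nβ−1}/Γ(nβ)) · I_{(t−s)/(τ−s)}((n−1)β, β); (b) for all 0 ≤ s ≤ t ≤ T and every n ≥ 1, the diagonal value satisfies κ^{n,t}_{s,t} = (λ^{−nβ} α^n/Γ(nβ)) · γ(nβ, λ(t−s)), where γ(a,x) := ∫_0^x e^{−v} v^{a−1} dv is the lower incomplete Gamma function. -/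

import Mathlib

open MeasureTheory Matrix

noncomputable section

/-- The simplex `Δ^n_{s,t}` of nondecreasing `n`-tuples with values in `[s,t]`. -/
def volSimplex (n : ℕ) (s t : ℝ) : Set (Fin n → ℝ) :=
  {r | (∀ i, r i ∈ Set.Icc s t) ∧ ∀ i j : Fin n, i ≤ j → r i ≤ r j}

/-- `r_{l+1}`, with the convention that `r_{n+1} = τ`. -/
def nxt {n : ℕ} (r : Fin n → ℝ) (τ : ℝ) (l : Fin n) : ℝ :=
  if h : (l : ℕ) + 1 < n then r ⟨(l : ℕ) + 1, h⟩ else τ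

/-- The chain `s = r̃_0, r̃_1 = r_1, …, r̃_n = r_n, r̃_{n+1} = τ`. -/
def chain {n : ℕ} (s τ : ℝ) (r : Fin n → ℝ) : Fin (n + 2) → ℝ := fun i =>
  if h0 : (i : ℕ) = 0 then s
  else if h : (i : ℕ) ≤ n then r ⟨(i : ℕ) - 1, by omega⟩ else τ

/-- `κ^{n,τ}_{s,t}` for the scalar kernel `k`. -/
def kap (k : ℝ → ℝ → ℝ) (n : ℕ) (s t τ : ℝ) : ℝ :=
  ∫ r in volSimplex n s t, ∏ l : Fin n, k (nxt r τ l) (r l)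

/-- `κ̇^{n+1,τ}_{s,t}` for the scalar kernel `k` (superscript `n + 1`). -/
def kapDot (k : ℝ → ℝ → ℝ) (n : ℕ) (s t τ : ℝ) : ℝ :=
  ∫ r in volSimplex n s t,
    ∏ l : Fin (n + 1), k (chain s τ r l.succ) (chain s τ r l.castSucc)

/-- The regularized incomplete Beta function `I_x(a,b)`. -/
def regIncBeta (x a b : ℝ) : ℝ :=
  (Real.Gamma (a + b) / (Real.Gamma a * Real.Gamma b)) *
    ∫ u in (0:ℝ)..x, u ^ (a - 1) * (1 - u) ^ (b - 1)

/-- The lower incomplete Gamma function `γ(a,x) = ∫_0^x e^{-v} v^{a-1} dv`. -/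
def lowerGamma (a x : ℝ) : ℝ := ∫ v in (0:ℝ)..x, Real.exp (-v) * v ^ (a - 1)

open scoped ENNReal

lemma isClosed_volSimplex (n : ℕ) (s t : ℝ) : IsClosed (volSimplex n s t) := by
  have : volSimplex n s t = (⋂ i, {r : Fin n → ℝ | r i ∈ Set.Icc s t}) ∩
      ⋂ i, ⋂ j, ⋂ (_ : i ≤ j), {r | r i ≤ r j} := by
    ext r; simp [volSimplex]
  rw [this]
  refine (isClosed_iInter fun i => isClosed_Icc.preimage (continuous_apply i)).inter ?_
  exact isClosed_iInter fun i => isClosed_iInter fun j => isClosed_iInter fun _ =>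
    isClosed_le (continuous_apply i) (continuous_apply j)

lemma measurable_chain_apply {n : ℕ} (s τ : ℝ) (i : Fin (n + 2)) :
    Measurable fun r : Fin n → ℝ => chain s τ r i := by
  unfold chain
  split_ifs <;> fun_prop

lemma measurable_nxt_apply {n : ℕ} (τ : ℝ) (l : Fin n) :
    Measurable fun r : Fin n → ℝ => nxt r τ l := by
  unfold nxt
  split_ifs <;> fun_prop

lemma measurable_prod_chain {M : Type*} [CommMonoid M] [MeasurableSpace M] [MeasurableMul₂ M]
    {k : ℝ → ℝ → M} (hk : Measurable fun p : ℝ × ℝ => k p.1 p.2) (n : ℕ) (s τ : ℝ) :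
    Measurable fun r : Fin n → ℝ =>
      ∏ l : Fin (n + 1), k (chain s τ r l.succ) (chain s τ r l.castSucc) := by
  refine Finset.measurable_fun_prod _ fun l _ => ?_
  have := (measurable_chain_apply s τ l.succ).prodMk (measurable_chain_apply s τ l.castSucc)
  exact hk.comp this

lemma measurable_prod_nxt {M : Type*} [CommMonoid M] [MeasurableSpace M] [MeasurableMul₂ M]
    {k : ℝ → ℝ → M} (hk : Measurable fun p : ℝ × ℝ => k p.1 p.2) (n : ℕ) (τ : ℝ) :
    Measurable fun r : Fin n → ℝ => ∏ l : Fin n, k (nxt r τ l) (r l) := by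
  refine Finset.measurable_fun_prod _ fun l _ => ?_
  have := (measurable_nxt_apply τ l).prodMk (measurable_pi_apply l)
  exact hk.comp this

/-- Tonelli's theorem on `ℝ^{n+1}`, splitting off the `i`-th coordinate. -/
lemma setLIntegral_insertNth {n : ℕ} (i : Fin (n + 1)) {S : Set (Fin (n + 1) → ℝ)} {A : Set ℝ}
    {B : ℝ → Set (Fin n → ℝ)} (hS : MeasurableSet S) (hA : MeasurableSet A)
    (hB : ∀ u, MeasurableSet (B u))
    (hSAB : ∀ u r, i.insertNth (α := fun _ => ℝ) u r ∈ S ↔ u ∈ A ∧ r ∈ B u)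
    {F : (Fin (n + 1) → ℝ) → ℝ≥0∞} (hF : Measurable F) :
    ∫⁻ r in S, F r = ∫⁻ u in A, ∫⁻ r in B u, F (i.insertNth (α := fun _ => ℝ) u r) := by
  have he := (volume_preserving_piFinSuccAbove (fun _ : Fin (n + 1) => ℝ) i).symm
  rw [← lintegral_indicator hS, ← he.lintegral_comp (hF.indicator hS), Measure.volume_eq_prod,
    lintegral_prod (fun z => S.indicator F ((MeasurableEquiv.piFinSuccAbove _ i).symm z))
      ((hF.indicator hS).comp he.measurable).aemeasurable,
    ← lintegral_indicator hA]
  refine lintegral_congr fun u => ?_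
  by_cases hu : u ∈ A
  · rw [Set.indicator_of_mem hu, ← lintegral_indicator (hB u)]
    refine lintegral_congr fun r => ?_
    change S.indicator F (i.insertNth (α := fun _ => ℝ) u r) = _
    by_cases hr : r ∈ B u
    · rw [Set.indicator_of_mem hr, Set.indicator_of_mem ((hSAB u r).2 ⟨hu, hr⟩)]
    · rw [Set.indicator_of_notMem hr, Set.indicator_of_notMem fun h => hr ((hSAB u r).1 h).2]
  · rw [Set.indicator_of_notMem hu]
    refine lintegral_eq_zero_of_ae_eq_zero (.of_forall fun r => ?_)
    exact Set.indicator_of_notMem (fun h => hu ((hSAB u r).1 h).1) _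

lemma cons_mem_volSimplex {n : ℕ} {s t u : ℝ} {r : Fin n → ℝ} :
    (Fin.cons u r : Fin (n + 1) → ℝ) ∈ volSimplex (n + 1) s t ↔
      u ∈ Set.Icc s t ∧ r ∈ volSimplex n u t := by
  simp only [volSimplex, Set.mem_ofPred_eq, Fin.forall_fin_succ, Fin.cons_zero, Fin.cons_succ,
    Set.mem_Icc, Fin.succ_le_succ_iff, Fin.zero_le, true_imp_iff, le_refl, true_and,
    Fin.le_zero_iff, Fin.succ_ne_zero, false_imp_iff]
  constructor
  · rintro ⟨⟨h1, h2⟩, h3, h4⟩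
    exact ⟨h1, fun i => ⟨h3 i, (h2 i).2⟩, h4⟩
  · rintro ⟨h1, h2, h3⟩
    exact ⟨⟨h1, fun i => ⟨h1.1.trans (h2 i).1, (h2 i).2⟩⟩, fun i => (h2 i).1, h3⟩

lemma snoc_mem_volSimplex {n : ℕ} {s t u : ℝ} {r : Fin n → ℝ} :
    (Fin.snoc r u : Fin (n + 1) → ℝ) ∈ volSimplex (n + 1) s t ↔
      u ∈ Set.Icc s t ∧ r ∈ volSimplex n s u := by
  simp only [volSimplex, Set.mem_ofPred_eq, Fin.forall_fin_succ', Fin.snoc_castSucc, Fin.snoc_last,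
    Set.mem_Icc, Fin.castSucc_le_castSucc_iff, Fin.le_last, true_imp_iff, le_refl, and_true]
  constructor
  · rintro ⟨⟨h1, h2⟩, h3, -⟩
    exact ⟨h2, fun i => ⟨(h1 i).1, (h3 i).2⟩, fun i => (h3 i).1⟩
  · rintro ⟨h1, h2, h3⟩
    refine ⟨⟨fun i => ⟨(h2 i).1, (h2 i).2.trans h1.2⟩, h1⟩, fun i => ⟨h3 i, (h2 i).2⟩, ?_⟩
    exact fun i h => absurd h (Fin.castSucc_lt_last i).not_ge

lemma chain_last {n : ℕ} (s τ : ℝ) (r : Fin n → ℝ) : chain s τ r (Fin.last (n + 1)) = τ := by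
  simp [chain]

lemma chain_snoc_castSucc {n : ℕ} (s τ u : ℝ) (r : Fin n → ℝ) (i : Fin (n + 2)) :
    chain s τ (Fin.snoc r u : Fin (n + 1) → ℝ) i.castSucc = chain s u r i := by
  have := i.2
  simp only [chain, Fin.snoc, Fin.val_castSucc]
  split_ifs <;> first | omega | rfl

lemma chain_castSucc_succ {n : ℕ} (s τ : ℝ) (r : Fin n → ℝ) (l : Fin n) :
    chain s τ r l.castSucc.succ = r l := by
  simp [chain]

lemma chain_castSucc_eq_cons {n : ℕ} (u τ : ℝ) (r : Fin n → ℝ) (l : Fin (n + 1)) :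
    chain u τ r l.castSucc = (Fin.cons u r : Fin (n + 1) → ℝ) l := by
  refine Fin.cases ?_ (fun i => ?_) l
  · simp [chain]
  · rw [← Fin.succ_castSucc, chain_castSucc_succ, Fin.cons_succ]

lemma nxt_cons {n : ℕ} (u τ : ℝ) (r : Fin n → ℝ) (l : Fin (n + 1)) :
    nxt (Fin.cons u r : Fin (n + 1) → ℝ) τ l = chain u τ r l.succ := by
  refine Fin.lastCases ?_ (fun i => ?_) l
  · simp [nxt, chain]
  · rw [chain_castSucc_succ]
    simp [nxt, ← Fin.succ_mk]

/-- The `[0,∞]`-valued analogue of `kapDot`. -/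
def lkapDot (K : ℝ → ℝ → ℝ≥0∞) (n : ℕ) (s t τ : ℝ) : ℝ≥0∞ :=
  ∫⁻ r in volSimplex n s t,
    ∏ l : Fin (n + 1), K (chain s τ r l.succ) (chain s τ r l.castSucc)

/-- The `[0,∞]`-valued analogue of `kap`. -/
def lkap (K : ℝ → ℝ → ℝ≥0∞) (n : ℕ) (s t τ : ℝ) : ℝ≥0∞ :=
  ∫⁻ r in volSimplex n s t, ∏ l : Fin n, K (nxt r τ l) (r l)

lemma lkapDot_zero (K : ℝ → ℝ → ℝ≥0∞) (s t τ : ℝ) : lkapDot K 0 s t τ = K τ s := by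
  have hS : volSimplex 0 s t = Set.univ := by ext; simp [volSimplex]
  simp [lkapDot, hS, chain, lintegral_unique, volume_pi]

lemma lkapDot_succ {K : ℝ → ℝ → ℝ≥0∞} (hK : Measurable fun p : ℝ × ℝ => K p.1 p.2)
    (n : ℕ) (s t τ : ℝ) :
    lkapDot K (n + 1) s t τ = ∫⁻ u in Set.Icc s t, lkapDot K n s u u * K τ u := by
  unfold lkapDot
  rw [setLIntegral_insertNth (Fin.last n) (A := Set.Icc s t) (B := fun u => volSimplex n s u)
    (isClosed_volSimplex _ _ _).measurableSet measurableSet_Icc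
    (fun _ => (isClosed_volSimplex _ _ _).measurableSet)
    (fun u r => by rw [Fin.insertNth_last']; exact snoc_mem_volSimplex)
    (measurable_prod_chain hK _ _ _)]
  refine lintegral_congr fun u => ?_
  rw [← lintegral_mul_const _ (measurable_prod_chain hK _ _ _)]
  refine lintegral_congr fun r => ?_
  rw [Fin.insertNth_last', Fin.prod_univ_castSucc]
  congr 1
  · refine Finset.prod_congr rfl fun l _ => ?_
    rw [Fin.succ_castSucc, chain_snoc_castSucc, chain_snoc_castSucc]
  · rw [chain_snoc_castSucc, chain_last, Fin.succ_last, chain_last]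

lemma lkap_succ {K : ℝ → ℝ → ℝ≥0∞} (hK : Measurable fun p : ℝ × ℝ => K p.1 p.2)
    (n : ℕ) (s t τ : ℝ) :
    lkap K (n + 1) s t τ = ∫⁻ u in Set.Icc s t, lkapDot K n u t τ := by
  unfold lkap lkapDot
  rw [setLIntegral_insertNth 0 (A := Set.Icc s t) (B := fun u => volSimplex n u t)
    (isClosed_volSimplex _ _ _).measurableSet measurableSet_Icc
    (fun _ => (isClosed_volSimplex _ _ _).measurableSet)
    (fun u r => by rw [Fin.insertNth_zero']; exact cons_mem_volSimplex)
    (measurable_prod_nxt hK _ _)]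
  refine lintegral_congr fun u => lintegral_congr fun r => ?_
  simp only [Fin.insertNth_zero', nxt_cons, chain_castSucc_eq_cons]

lemma nxt_ge {n : ℕ} {s t τ : ℝ} {r : Fin n → ℝ} (hr : r ∈ volSimplex n s t) (ht : t ≤ τ)
    (l : Fin n) : r l ≤ nxt r τ l := by
  unfold nxt
  split_ifs with h
  · exact hr.2 _ _ (Fin.mk_le_mk.2 (Nat.le_succ _))
  · exact (hr.1 l).2.trans ht

lemma chain_castSucc_le_succ {n : ℕ} {s t τ : ℝ} {r : Fin n → ℝ} (hr : r ∈ volSimplex n s t)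
    (hst : s ≤ t) (ht : t ≤ τ) (l : Fin (n + 1)) :
    chain s τ r l.castSucc ≤ chain s τ r l.succ := by
  rw [← nxt_cons, chain_castSucc_eq_cons]
  exact nxt_ge (cons_mem_volSimplex.2 ⟨Set.left_mem_Icc.2 hst, hr⟩) ht l

lemma kapDot_eq_toReal {k : ℝ → ℝ → ℝ} (hk : Measurable fun p : ℝ × ℝ => k p.1 p.2)
    (hk0 : ∀ a c, c ≤ a → 0 ≤ k a c) (n : ℕ) {s t τ : ℝ} (hst : s ≤ t) (ht : t ≤ τ) :
    kapDot k n s t τ = (lkapDot (fun a c => .ofReal (k a c)) n s t τ).toReal := by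
  have hS := (isClosed_volSimplex n s t).measurableSet
  have h0 : ∀ r ∈ volSimplex n s t, ∀ l : Fin (n + 1),
      0 ≤ k (chain s τ r l.succ) (chain s τ r l.castSucc) :=
    fun r hr l => hk0 _ _ (chain_castSucc_le_succ hr hst ht l)
  rw [kapDot, lkapDot, integral_eq_lintegral_of_nonneg_ae]
  · refine congrArg _ (setLIntegral_congr_fun hS fun r hr => ?_)
    exact ENNReal.ofReal_prod_of_nonneg fun l _ => h0 r hr l
  · exact ae_restrict_of_forall_mem hS fun r hr => Finset.prod_nonneg fun l _ => h0 r hr l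
  · exact (measurable_prod_chain hk n s τ).aestronglyMeasurable

lemma kap_eq_toReal {k : ℝ → ℝ → ℝ} (hk : Measurable fun p : ℝ × ℝ => k p.1 p.2)
    (hk0 : ∀ a c, c ≤ a → 0 ≤ k a c) (n : ℕ) {s t τ : ℝ} (ht : t ≤ τ) :
    kap k n s t τ = (lkap (fun a c => .ofReal (k a c)) n s t τ).toReal := by
  have hS := (isClosed_volSimplex n s t).measurableSet
  have h0 : ∀ r ∈ volSimplex n s t, ∀ l : Fin n, 0 ≤ k (nxt r τ l) (r l) :=
    fun r hr l => hk0 _ _ (nxt_ge hr ht l)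
  rw [kap, lkap, integral_eq_lintegral_of_nonneg_ae]
  · refine congrArg _ (setLIntegral_congr_fun hS fun r hr => ?_)
    exact ENNReal.ofReal_prod_of_nonneg fun l _ => h0 r hr l
  · exact ae_restrict_of_forall_mem hS fun r hr => Finset.prod_nonneg fun l _ => h0 r hr l
  · exact (measurable_prod_nxt hk n τ).aestronglyMeasurable

lemma setLIntegral_Icc_ofReal {f : ℝ → ℝ} {s t : ℝ} (hst : s ≤ t)
    (hf : IntervalIntegrable f volume s t) (hf0 : ∀ u ∈ Set.Icc s t, 0 ≤ f u) :
    ∫⁻ u in Set.Icc s t, ENNReal.ofReal (f u) = ENNReal.ofReal (∫ u in s..t, f u) := by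
  rw [intervalIntegral.integral_of_le hst, ← integral_Icc_eq_integral_Ioc,
    ofReal_integral_eq_lintegral_ofReal]
  · exact (intervalIntegrable_iff_integrableOn_Icc_of_le hst).1 hf
  · exact ae_restrict_of_forall_mem measurableSet_Icc hf0

lemma ofReal_beta_integrand (a b : ℝ) {v : ℝ} (hv : v ∈ Set.Icc (0 : ℝ) 1) :
    (v : ℂ) ^ ((a : ℂ) - 1) * (1 - (v : ℂ)) ^ ((b : ℂ) - 1) =
      ((v ^ (a - 1) * (1 - v) ^ (b - 1) : ℝ) : ℂ) := by
  rw [Complex.ofReal_mul, Complex.ofReal_cpow hv.1, Complex.ofReal_cpow (sub_nonneg.2 hv.2)]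
  push_cast
  rfl

lemma intervalIntegrable_beta {a b : ℝ} (ha : 0 < a) (hb : 0 < b) :
    IntervalIntegrable (fun v : ℝ => v ^ (a - 1) * (1 - v) ^ (b - 1)) volume 0 1 := by
  have h := Complex.betaIntegral_convergent (u := a) (v := b) (by simpa) (by simpa)
  rw [intervalIntegrable_iff_integrableOn_Ioc_of_le zero_le_one] at h ⊢
  refine (IntegrableOn.congr_fun h.re (fun v hv => ?_) measurableSet_Ioc)
  simp only [RCLike.re_to_complex]
  rw [ofReal_beta_integrand a b ⟨hv.1.le, hv.2⟩, Complex.ofReal_re]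

lemma setLIntegral_beta {a b s t τ : ℝ} (ha : 0 < a) (hb : 0 < b) (hst : s < t) (ht : t ≤ τ) :
    ∫⁻ u in Set.Icc s t, ENNReal.ofReal ((u - s) ^ (a - 1) * (τ - u) ^ (b - 1)) =
      ENNReal.ofReal ((τ - s) ^ (a + b - 1) *
        ∫ v in (0:ℝ)..(t - s) / (τ - s), v ^ (a - 1) * (1 - v) ^ (b - 1)) := by
  have hL : 0 < τ - s := by linarith
  have hx0 : 0 ≤ (t - s) / (τ - s) := by have := hst.le; positivity
  have hx1 : (t - s) / (τ - s) ≤ 1 := (div_le_one hL).2 (by linarith)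
  set f : ℝ → ℝ := fun v => v ^ (a - 1) * (1 - v) ^ (b - 1) with hfdef
  have hf : IntervalIntegrable f volume 0 ((t - s) / (τ - s)) :=
    (intervalIntegrable_beta ha hb).mono_set (by
      rw [Set.uIcc_of_le hx0, Set.uIcc_of_le zero_le_one]
      exact Set.Icc_subset_Icc_right hx1)
  have hg : IntervalIntegrable (fun u => f ((u - s) * (τ - s)⁻¹)) volume s t := by
    have := (hf.comp_mul_right (c := (τ - s)⁻¹)).comp_sub_right s
    simpa [div_mul_cancel₀ _ hL.ne'] using this
  have hpt : ∀ u ∈ Set.Icc s t, (u - s) ^ (a - 1) * (τ - u) ^ (b - 1) =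
      (τ - s) ^ (a + b - 2) * f ((u - s) * (τ - s)⁻¹) := by
    intro u hu
    have h1 : 1 - (u - s) * (τ - s)⁻¹ = (τ - u) * (τ - s)⁻¹ := by field_simp; ring
    have h2 : (τ - s) ^ (a + b - 2) = (τ - s) ^ (a - 1) * (τ - s) ^ (b - 1) := by
      rw [← Real.rpow_add hL]; ring_nf
    simp only [hfdef]
    rw [h1, h2, Real.mul_rpow (sub_nonneg.2 hu.1) (inv_nonneg.2 hL.le),
      Real.mul_rpow (sub_nonneg.2 (hu.2.trans ht)) (inv_nonneg.2 hL.le), Real.inv_rpow hL.le,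
      Real.inv_rpow hL.le]
    have := (Real.rpow_pos_of_pos hL (a - 1)).ne'
    have := (Real.rpow_pos_of_pos hL (b - 1)).ne'
    field_simp
  rw [setLIntegral_congr_fun measurableSet_Icc fun u hu => congrArg _ (hpt u hu),
    setLIntegral_Icc_ofReal hst.le (hg.const_mul _)]
  · have h3 : ∫ u in s..t, f ((u - s) * (τ - s)⁻¹) =
        (τ - s) * ∫ v in (0:ℝ)..(t - s) / (τ - s), f v := by
      rw [intervalIntegral.integral_comp_sub_right (fun u => f (u * (τ - s)⁻¹)),
        intervalIntegral.integral_comp_mul_right _ (inv_ne_zero hL.ne')]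
      simp [div_eq_mul_inv]
    have h4 : (τ - s) ^ (a + b - 1) = (τ - s) ^ (a + b - 2) * (τ - s) := by
      rw [← Real.rpow_add_one hL.ne']; ring_nf
    rw [intervalIntegral.integral_const_mul, h3, h4, mul_assoc]
  · intro u hu
    rw [← hpt u hu]
    exact mul_nonneg (Real.rpow_nonneg (sub_nonneg.2 hu.1) _)
      (Real.rpow_nonneg (sub_nonneg.2 (hu.2.trans ht)) _)

lemma setLIntegral_exp_mul_rpow {a lam s t : ℝ} (ha : 0 < a) (hlam : 0 < lam) (hst : s ≤ t) :
    ∫⁻ u in Set.Icc s t, ENNReal.ofReal (Real.exp (-lam * (t - u)) * (t - u) ^ (a - 1)) =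
      ENNReal.ofReal (lam ^ (-a) * lowerGamma a (lam * (t - s))) := by
  set f : ℝ → ℝ := fun w => Real.exp (-lam * w) * w ^ (a - 1) with hfdef
  have hf : IntervalIntegrable f volume 0 (t - s) :=
    (intervalIntegral.intervalIntegrable_rpow' (by linarith)).continuousOn_mul (by fun_prop)
  have hg : IntervalIntegrable (fun u => f (t - u)) volume s t := by
    simpa using (hf.comp_sub_left t).symm
  change ∫⁻ u in Set.Icc s t, ENNReal.ofReal (f (t - u)) = _
  rw [setLIntegral_Icc_ofReal hst hg fun u hu =>
      mul_nonneg (Real.exp_nonneg _) (Real.rpow_nonneg (sub_nonneg.2 hu.2) _),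
    intervalIntegral.integral_comp_sub_left, sub_self, lowerGamma]
  have hpt : ∀ w ∈ Set.uIcc 0 (t - s),
      f w = lam ^ (1 - a) * (Real.exp (-(lam * w)) * (lam * w) ^ (a - 1)) := by
    intro w hw
    rw [Set.uIcc_of_le (sub_nonneg.2 hst)] at hw
    have h1 : lam ^ (1 - a) * lam ^ (a - 1) = 1 := by
      rw [← Real.rpow_add hlam, sub_add_sub_cancel, sub_self, Real.rpow_zero]
    simp only [hfdef]
    rw [Real.mul_rpow hlam.le hw.1, neg_mul]
    linear_combination (-Real.exp (-(lam * w)) * w ^ (a - 1)) * h1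
  have h2 : lam ^ (-a) = lam ^ (1 - a) * lam⁻¹ := by
    rw [← Real.rpow_neg_one, ← Real.rpow_add hlam]; ring_nf
  rw [intervalIntegral.integral_congr hpt, intervalIntegral.integral_const_mul,
    intervalIntegral.integral_comp_mul_left (fun v => Real.exp (-v) * v ^ (a - 1)) hlam.ne',
    mul_zero, smul_eq_mul, h2, mul_assoc]

lemma regIncBeta_one {a b : ℝ} (ha : 0 < a) (hb : 0 < b) : regIncBeta 1 a b = 1 := by
  have h : ∫ u in (0:ℝ)..1, u ^ (a - 1) * (1 - u) ^ (b - 1) = ProbabilityTheory.beta a b := by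
    rw [ProbabilityTheory.beta_eq_betaIntegralReal a b ha hb, Complex.betaIntegral,
      intervalIntegral.integral_congr fun v hv =>
        ofReal_beta_integrand a b (by rwa [Set.uIcc_of_le zero_le_one] at hv),
      intervalIntegral.integral_ofReal, Complex.ofReal_re]
  have := (Real.Gamma_pos_of_pos ha).ne'
  have := (Real.Gamma_pos_of_pos hb).ne'
  have := (Real.Gamma_pos_of_pos (add_pos ha hb)).ne'
  rw [regIncBeta, h, ProbabilityTheory.beta]
  field_simp

/-- The Gamma kernel `k(a, c) = (α/Γ(β)) e^{-λ(a-c)} (a-c)^{β-1}`. -/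
def gammaKernel (α β lam a c : ℝ) : ℝ :=
  α / Real.Gamma β * Real.exp (-lam * (a - c)) * (a - c) ^ (β - 1)

lemma measurable_gammaKernel (α β lam : ℝ) :
    Measurable fun p : ℝ × ℝ => gammaKernel α β lam p.1 p.2 := by
  unfold gammaKernel
  fun_prop

lemma gammaKernel_nonneg {α β : ℝ} (lam : ℝ) (hα : 0 < α) (hβ : 0 < β) {a c : ℝ} (h : c ≤ a) :
    0 ≤ gammaKernel α β lam a c := by
  have := Real.Gamma_pos_of_pos hβ
  have := Real.rpow_nonneg (sub_nonneg.2 h) (β - 1)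
  unfold gammaKernel
  positivity

lemma lkapDot_gammaKernel_succ_of_diag {α β lam : ℝ} (hα : 0 < α) (hβ : 0 < β) {n : ℕ} {s : ℝ}
    (hdiag : ∀ u, s < u → lkapDot (fun a c => .ofReal (gammaKernel α β lam a c)) n s u u =
      .ofReal (gammaKernel (α ^ (n + 1)) ((n + 1) * β) lam u s))
    {t τ : ℝ} (hst : s < t) (ht : t ≤ τ) :
    lkapDot (fun a c => .ofReal (gammaKernel α β lam a c)) (n + 1) s t τ =
      .ofReal (gammaKernel (α ^ (n + 2)) ((n + 2) * β) lam τ s *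
        regIncBeta ((t - s) / (τ - s)) ((n + 1) * β) β) := by
  have ha : 0 < ((n : ℝ) + 1) * β := by positivity
  have hΓa := Real.Gamma_pos_of_pos ha
  have hΓβ := Real.Gamma_pos_of_pos hβ
  have hΓs := Real.Gamma_pos_of_pos (add_pos ha hβ)
  set C := α ^ (n + 1) / Real.Gamma ((n + 1) * β) * (α / Real.Gamma β) *
    Real.exp (-lam * (τ - s)) with hC
  have hC0 : 0 ≤ C := by positivity
  have hpt : ∀ u ∈ Set.Ioo s t, lkapDot (fun a c => .ofReal (gammaKernel α β lam a c)) n s u u *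
      ENNReal.ofReal (gammaKernel α β lam τ u) = ENNReal.ofReal C *
        ENNReal.ofReal ((u - s) ^ ((n + 1) * β - 1) * (τ - u) ^ (β - 1)) := by
    intro u hu
    rw [hdiag u hu.1, ← ENNReal.ofReal_mul (gammaKernel_nonneg lam (by positivity) ha hu.1.le),
      ← ENNReal.ofReal_mul hC0]
    have : Real.exp (-lam * (τ - s)) = Real.exp (-lam * (u - s)) * Real.exp (-lam * (τ - u)) := by
      rw [← Real.exp_add]; ring_nf
    congr 1
    rw [hC, this, gammaKernel, gammaKernel]
    ring
  rw [lkapDot_succ (measurable_gammaKernel α β lam).ennreal_ofReal,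
    ← Measure.restrict_congr_set Ioo_ae_eq_Icc, setLIntegral_congr_fun measurableSet_Ioo hpt,
    Measure.restrict_congr_set Ioo_ae_eq_Icc, lintegral_const_mul' _ _ ENNReal.ofReal_ne_top,
    setLIntegral_beta ha hβ hst ht, ← ENNReal.ofReal_mul hC0]
  congr 1
  have h2 : ((n : ℝ) + 2) * β = (n + 1) * β + β := by ring
  rw [hC, gammaKernel, regIncBeta, h2]
  field_simp
  ring

lemma lkapDot_gammaKernel_diag {α β lam : ℝ} (hα : 0 < α) (hβ : 0 < β) (n : ℕ) {s t : ℝ}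
    (hst : s < t) :
    lkapDot (fun a c => .ofReal (gammaKernel α β lam a c)) n s t t =
      .ofReal (gammaKernel (α ^ (n + 1)) ((n + 1) * β) lam t s) := by
  induction n generalizing t with
  | zero => simp [lkapDot_zero]
  | succ n ih =>
    rw [lkapDot_gammaKernel_succ_of_diag hα hβ (fun u hu => ih hu) hst le_rfl,
      div_self (sub_pos.2 hst).ne', regIncBeta_one (by positivity) hβ, mul_one]
    push_cast
    ring_nf

lemma lkap_gammaKernel_succ {α β lam : ℝ} (hα : 0 < α) (hβ : 0 < β) (hlam : 0 < lam) (n : ℕ)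
    {s t : ℝ} (hst : s ≤ t) :
    lkap (fun a c => .ofReal (gammaKernel α β lam a c)) (n + 1) s t t =
      .ofReal (α ^ (n + 1) / Real.Gamma ((n + 1) * β) *
        (lam ^ (-((n + 1) * β)) * lowerGamma ((n + 1) * β) (lam * (t - s)))) := by
  have ha : 0 < ((n : ℝ) + 1) * β := by positivity
  have hΓa := Real.Gamma_pos_of_pos ha
  have hC0 : 0 ≤ α ^ (n + 1) / Real.Gamma ((n + 1) * β) := by positivity
  have hpt : ∀ u ∈ Set.Ioo s t, lkapDot (fun a c => .ofReal (gammaKernel α β lam a c)) n u t t =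
      ENNReal.ofReal (α ^ (n + 1) / Real.Gamma ((n + 1) * β)) *
        ENNReal.ofReal (Real.exp (-lam * (t - u)) * (t - u) ^ ((n + 1) * β - 1)) := by
    intro u hu
    rw [lkapDot_gammaKernel_diag hα hβ n hu.2, ← ENNReal.ofReal_mul hC0, gammaKernel, mul_assoc]
  rw [lkap_succ (measurable_gammaKernel α β lam).ennreal_ofReal,
    ← Measure.restrict_congr_set Ioo_ae_eq_Icc, setLIntegral_congr_fun measurableSet_Ioo hpt,
    Measure.restrict_congr_set Ioo_ae_eq_Icc, lintegral_const_mul' _ _ ENNReal.ofReal_ne_top,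
    setLIntegral_exp_mul_rpow ha hlam hst, ← ENNReal.ofReal_mul hC0]

lemma regIncBeta_nonneg {x a b : ℝ} (ha : 0 < a) (hb : 0 < b) (hx0 : 0 ≤ x) (hx1 : x ≤ 1) :
    0 ≤ regIncBeta x a b := by
  have := Real.Gamma_pos_of_pos ha
  have := Real.Gamma_pos_of_pos hb
  have := Real.Gamma_pos_of_pos (add_pos ha hb)
  refine mul_nonneg (by positivity) (intervalIntegral.integral_nonneg hx0 fun u hu => ?_)
  exact mul_nonneg (Real.rpow_nonneg hu.1 _) (Real.rpow_nonneg (by linarith [hu.2]) _)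

lemma lowerGamma_nonneg (a : ℝ) {x : ℝ} (hx : 0 ≤ x) : 0 ≤ lowerGamma a x :=
  intervalIntegral.integral_nonneg hx fun _ hv =>
    mul_nonneg (Real.exp_nonneg _) (Real.rpow_nonneg hv.1 _)

/-- Gamma kernel `k(t,s) = (α/Γ(β)) e^{-λ(t-s)} (t-s)^{β-1}`:
(a) off-diagonal closed form for `κ̇^{n,τ}` for `n ≥ 2` (written `κ̇^{n+2} = kapDot k (n+1)`);
(b) diagonal closed form for `κ^{n,t}` for `n ≥ 1` (written `κ^{n+1} = kap k (n+1)`). -/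
theorem stmt8 {T : ℝ} (hT : 0 < T) (α β lam : ℝ) (hα : 0 < α) (hβ : 0 < β) (hlam : 0 < lam) :
    (∀ (n : ℕ) (s t τ : ℝ), 0 ≤ s → s < t → t ≤ τ → τ ≤ T →
      kapDot (fun a c => α / Real.Gamma β * Real.exp (-lam * (a - c)) * (a - c) ^ (β - 1))
          (n + 1) s t τ
        = α ^ (n + 2) * Real.exp (-lam * (τ - s))
            * ((τ - s) ^ (((n : ℝ) + 2) * β - 1) / Real.Gamma (((n : ℝ) + 2) * β))
            * regIncBeta ((t - s) / (τ - s)) (((n : ℝ) + 1) * β) β) ∧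
    (∀ (n : ℕ) (s t : ℝ), 0 ≤ s → s ≤ t → t ≤ T →
      kap (fun a c => α / Real.Gamma β * Real.exp (-lam * (a - c)) * (a - c) ^ (β - 1))
          (n + 1) s t t
        = lam ^ (-(((n : ℝ) + 1) * β)) * α ^ (n + 1) / Real.Gamma (((n : ℝ) + 1) * β)
            * lowerGamma (((n : ℝ) + 1) * β) (lam * (t - s))) := by
  refine ⟨fun n s t τ _ hst ht _ => ?_, fun n s t _ hst _ => ?_⟩
  · change kapDot (gammaKernel α β lam) (n + 1) s t τ = _
    have hτ : 0 < τ - s := by linarith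
    rw [kapDot_eq_toReal (measurable_gammaKernel α β lam)
        (fun a c h => gammaKernel_nonneg lam hα hβ h) (n + 1) hst.le ht,
      lkapDot_gammaKernel_succ_of_diag hα hβ (fun u hu => lkapDot_gammaKernel_diag hα hβ n hu)
        hst ht, ENNReal.toReal_ofReal, gammaKernel]
    · ring
    · refine mul_nonneg (gammaKernel_nonneg lam (by positivity) (by positivity) (hst.le.trans ht))
        (regIncBeta_nonneg (by positivity) hβ ?_ ?_)
      · exact div_nonneg (sub_nonneg.2 hst.le) hτ.le
      · exact (div_le_one hτ).2 (by linarith)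
  · change kap (gammaKernel α β lam) (n + 1) s t t = _
    have hΓ : 0 < Real.Gamma (((n : ℝ) + 1) * β) := Real.Gamma_pos_of_pos (by positivity)
    have hγ := lowerGamma_nonneg (((n : ℝ) + 1) * β) (mul_nonneg hlam.le (sub_nonneg.2 hst))
    rw [kap_eq_toReal (measurable_gammaKernel α β lam)
        (fun a c h => gammaKernel_nonneg lam hα hβ h) (n + 1) le_rfl,
      lkap_gammaKernel_succ hα hβ hlam n hst, ENNReal.toReal_ofReal (by positivity)]
    ring
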